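/- Let n be a positive integer such that the cyclic group ℤ_n is a BCI-group. Then n = 2^i · 3^j · p₁^{α₁} ⋯ p_k^{α_k} where 0 ≤ i ≤ 2, 0 ≤ j ≤ 2, the p_t are distinct primes different from 2 and 3, and 0 ≤ α_t ≤ 1 for each t. Equivalently, the 2-adic valuation of n is at most 2, the 3-adic valuation of n is at most 2, and the p-adic valuation of n is at most 1 for every prime p ≥ 5. -/

import Mathlib

open SimpleGraph

/-- The bi-Cayley graph `BCay(G,S)`: vertex set `G × {1,2}` (encoded as `G × Fin 2`,
where index `0` stands for part `1` and index `1` for part `2`), with edges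
`{(g,1),(sg,2)}` for `g ∈ G`, `s ∈ S`. -/
def BCay (G : Type*) [Group G] (S : Set G) : SimpleGraph (G × Fin 2) :=
  SimpleGraph.fromRel (fun u v => u.2 = 0 ∧ v.2 = 1 ∧ v.1 * u.1⁻¹ ∈ S)

/-- `BCay(G,S)` is a BCI-graph. -/
def IsBCIGraph (G : Type*) [Group G] (S : Set G) : Prop :=
  ∀ T : Set G, Nonempty (BCay G S ≃g BCay G T) →
    ∃ (g : G) (α : G ≃* G), T = (fun s => g * α s) '' S

/-- `G` is a BCI-group. -/
def IsBCIGroup (G : Type*) [Group G] : Prop :=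
  ∀ S : Set G, IsBCIGraph G S

/-- `G` is an `m`-BCI-group. -/
def IsmBCIGroup (G : Type*) [Group G] (m : ℕ) : Prop :=
  ∀ S : Set G, S.ncard ≤ m → IsBCIGraph G S

/-- The Cayley graph `Cay(G,S)`, for `1 ∉ S = S⁻¹`. -/
def Cay (G : Type*) [Group G] (S : Set G) : SimpleGraph G :=
  SimpleGraph.fromRel (fun x y => y * x⁻¹ ∈ S)

/-- `Cay(G,S)` is a CI-graph. -/
def IsCIGraph (G : Type*) [Group G] (S : Set G) : Prop :=
  ∀ T : Set G, 1 ∉ T → T⁻¹ = T → Nonempty (Cay G S ≃g Cay G T) →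
    ∃ α : G ≃* G, T = α '' S

/-- `G` is a CI-group. -/
def IsCIGroup (G : Type*) [Group G] : Prop :=
  ∀ S : Set G, 1 ∉ S → S⁻¹ = S → IsCIGraph G S

/-- `G` is an `m`-CI-group. -/
def IsmCIGroup (G : Type*) [Group G] (m : ℕ) : Prop :=
  ∀ S : Set G, 1 ∉ S → S⁻¹ = S → S.ncard ≤ m → IsCIGraph G S

section BiCayley

variable {G : Type*}

theorem BCay_adj [Group G] (S : Set G) (u v : G × Fin 2) :
    (BCay G S).Adj u v ↔
      (u.2 = 0 ∧ v.2 = 1 ∧ v.1 * u.1⁻¹ ∈ S) ∨ (v.2 = 0 ∧ u.2 = 1 ∧ u.1 * v.1⁻¹ ∈ S) := by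
  simp only [BCay, SimpleGraph.fromRel_adj, and_iff_right_iff_imp]
  rintro (⟨h0, h1, -⟩ | ⟨h0, h1, -⟩) rfl <;> simp [h0] at h1

/-- A permutation `f` of `G` carrying the quotients lying in `S` to the quotients lying in `T`
induces an isomorphism of bi-Cayley graphs acting by `f` on both parts. -/
def BCayIsoOfEquiv [Group G] {S T : Set G} (f : G ≃ G)
    (h : ∀ x y, y * x⁻¹ ∈ S ↔ f y * (f x)⁻¹ ∈ T) : BCay G S ≃g BCay G T where
  toEquiv := f.prodCongr (Equiv.refl _)
  map_rel_iff' := by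
    intro u v
    simp [BCay_adj, h]

/-- The decomposition of `G × Fin 2` into the cosets of the subgroup `H`. -/
noncomputable def cosetDecomposition [CommGroup G] (H : Subgroup G) :
    G × Fin 2 ≃ (G ⧸ H) × (H × Fin 2) where
  toFun v := (v.1, ⟨(v.1 : G ⧸ H).out⁻¹ * v.1, QuotientGroup.eq.mp (Quotient.out_eq' _)⟩, v.2)
  invFun w := (w.1.out * w.2.1, w.2.2)
  left_inv v := by simp
  right_inv w := by
    have hw : ((w.1.out * w.2.1 : G) : G ⧸ H) = w.1 := by
      rw [QuotientGroup.mk_mul_of_mem _ w.2.1.2]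
      exact Quotient.out_eq' _
    ext <;> simp [hw]

theorem BCay_image_subtype_adj [CommGroup G] (H : Subgroup G) (S : Set H) (u v : G × Fin 2) :
    (BCay G (H.subtype '' S)).Adj u v ↔
      (cosetDecomposition H u).1 = (cosetDecomposition H v).1 ∧
        (BCay H S).Adj (cosetDecomposition H u).2 (cosetDecomposition H v).2 := by
  have key : ∀ x y : G, y * x⁻¹ ∈ H.subtype '' S ↔ (x : G ⧸ H) = y ∧
      (cosetDecomposition H (y, 0)).2.1 * (cosetDecomposition H (x, 0)).2.1⁻¹ ∈ S := by
    intro x y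
    have hquot : (x : G ⧸ H) = y →
        (((cosetDecomposition H (y, 0)).2.1 * (cosetDecomposition H (x, 0)).2.1⁻¹ : H) : G) =
          y * x⁻¹ := by
      intro hxy
      simp only [cosetDecomposition, Equiv.coe_fn_mk, Subgroup.coe_mul, Subgroup.coe_inv, hxy]
      rw [mul_inv_rev, inv_inv, mul_comm x⁻¹, mul_mul_mul_comm, inv_mul_cancel, one_mul]
    constructor
    · rintro ⟨s, hs, hsxy⟩
      have hxy : (x : G ⧸ H) = y := by
        rw [QuotientGroup.eq, mul_comm, ← hsxy]
        exact s.2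
      refine ⟨hxy, ?_⟩
      convert hs
      exact Subtype.ext ((hquot hxy).trans hsxy.symm)
    · rintro ⟨hxy, hs⟩
      exact ⟨_, hs, hquot hxy⟩
  rw [BCay_adj, BCay_adj, key, key]
  simp only [cosetDecomposition, Equiv.coe_fn_mk]
  constructor
  · rintro (⟨h0, h1, hq, hs⟩ | ⟨h0, h1, hq, hs⟩)
    · exact ⟨hq, Or.inl ⟨h0, h1, hs⟩⟩
    · exact ⟨hq.symm, Or.inr ⟨h0, h1, hs⟩⟩
  · rintro ⟨hq, ⟨h0, h1, hs⟩ | ⟨h0, h1, hs⟩⟩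
    · exact Or.inl ⟨h0, h1, hq, hs⟩
    · exact Or.inr ⟨h0, h1, hq.symm, hs⟩

/-- An isomorphism of bi-Cayley graphs over a subgroup extends coset by coset. -/
noncomputable def BCayIsoExtend [CommGroup G] {H : Subgroup G} {S T : Set H}
    (e : BCay H S ≃g BCay H T) : BCay G (H.subtype '' S) ≃g BCay G (H.subtype '' T) where
  toEquiv := ((cosetDecomposition H).trans ((Equiv.refl _).prodCongr e.toEquiv)).trans
    (cosetDecomposition H).symm
  map_rel_iff' := by
    intro u v
    simp only [BCay_image_subtype_adj, Equiv.trans_apply, Equiv.apply_symm_apply]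
    simp only [Equiv.prodCongr_apply, Prod.map, Equiv.refl_apply]
    exact and_congr_right fun _ => e.map_rel_iff

theorem IsBCIGroup.of_characteristic [CommGroup G] (hG : IsBCIGroup G) (H : Subgroup G)
    [hH : H.Characteristic] : IsBCIGroup H := by
  rintro S T ⟨e⟩
  obtain ⟨g, α, hα⟩ := hG _ _ ⟨BCayIsoExtend e⟩
  have hmap : H.map α.toMonoidHom = H := Subgroup.characteristic_iff_map_eq.mp hH α
  have hmem : ∀ s : H, α s ∈ H := fun s =>
    hmap.le ⟨s, s.2, rfl⟩
  rcases S.eq_empty_or_nonempty with rfl | ⟨s, hs⟩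
  · refine ⟨1, MulEquiv.refl _, ?_⟩
    simpa using hα
  · have hg : g ∈ H := by
      have : g * α s ∈ H.subtype '' T := hα ▸ ⟨s, ⟨s, hs, rfl⟩, rfl⟩
      obtain ⟨t, -, ht⟩ := this
      rw [← H.mul_mem_cancel_right (hmem s), ← ht]
      exact t.2
    let β : H ≃* H := (α.subgroupMap H).trans (MulEquiv.subgroupCongr hmap)
    refine ⟨⟨g, hg⟩, β, ?_⟩
    apply Set.image_injective.mpr H.subtype_injective
    rw [hα, Set.image_image, Set.image_image]
    rfl

theorem IsBCIGroup.of_mulEquiv {G' : Type*} [Group G] [Group G'] (e : G ≃* G')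
    (hG : IsBCIGroup G) : IsBCIGroup G' := by
  have iso : ∀ S : Set G', Nonempty (BCay G (e ⁻¹' S) ≃g BCay G' S) := fun S =>
    ⟨{ toEquiv := e.toEquiv.prodCongr (Equiv.refl _)
       map_rel_iff' := by
        intro u v
        simp [BCay_adj] }⟩
  rintro S T ⟨f⟩
  obtain ⟨i⟩ := iso S
  obtain ⟨j⟩ := iso T
  obtain ⟨g, α, hα⟩ := hG _ _ ⟨(i.trans f).trans j.symm⟩
  refine ⟨e g, (e.symm.trans α).trans e, ?_⟩
  rw [← Set.image_preimage_eq T e.surjective, hα, Set.image_image]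
  conv_rhs => rw [← Set.image_preimage_eq S e.surjective, Set.image_image]
  simp

end BiCayley

section Cyclic

theorem IsBCIGroup.zmod_of_dvd {m n : ℕ} (hn : 0 < n) (hmn : m ∣ n)
    (hG : IsBCIGroup (Multiplicative (ZMod n))) : IsBCIGroup (Multiplicative (ZMod m)) := by
  have : NeZero n := ⟨hn.ne'⟩
  let H : Subgroup (Multiplicative (ZMod n)) := (powMonoidHom m).ker
  have hH : H.Characteristic := by
    rw [Subgroup.characteristic_iff_le_comap]
    intro α a ha
    simp only [H, MonoidHom.mem_ker, powMonoidHom_apply, Subgroup.mem_comap] at ha ⊢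
    rw [← map_pow, ha, map_one]
  have hcard : Nat.card H = Nat.card (Multiplicative (ZMod m)) := by
    rw [IsCyclic.card_powMonoidHom_ker, Nat.card_congr Multiplicative.toAdd,
      Nat.card_congr Multiplicative.toAdd, Nat.card_zmod, Nat.card_zmod, Nat.gcd_eq_right hmn]
  exact (hG.of_characteristic H).of_mulEquiv (mulEquivOfCyclicCardEq hcard)

theorem exists_affine_of_isBCIGroup {m : ℕ} (hG : IsBCIGroup (Multiplicative (ZMod m)))
    {S T : Set (ZMod m)} (f : ZMod m ≃ ZMod m) (h : ∀ x y, y - x ∈ S ↔ f y - f x ∈ T) :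
    ∃ g u : ZMod m, T = (fun s => g + u * s) '' S := by
  obtain ⟨g, α, hα⟩ := hG (Multiplicative.toAdd ⁻¹' S) (Multiplicative.toAdd ⁻¹' T)
    ⟨BCayIsoOfEquiv (Multiplicative.toAdd.trans (f.trans Multiplicative.ofAdd))
      fun x y => by simpa [sub_eq_add_neg] using h x.toAdd y.toAdd⟩
  have hlin : ∀ s : ZMod m, (α (.ofAdd s)).toAdd = (α (.ofAdd 1)).toAdd * s := by
    intro s
    obtain ⟨k, rfl⟩ := ZMod.intCast_surjective s
    have : Multiplicative.ofAdd (k : ZMod m) = Multiplicative.ofAdd 1 ^ k := by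
      rw [← ofAdd_zsmul, zsmul_one]
    rw [this, map_zpow, toAdd_zpow, zsmul_eq_mul, mul_comm]
  refine ⟨g.toAdd, (α (.ofAdd 1)).toAdd, ?_⟩
  ext t
  have ht := Set.ext_iff.mp hα (.ofAdd t)
  simp only [Set.mem_preimage, toAdd_ofAdd, Set.mem_image] at ht ⊢
  rw [ht]
  constructor
  · rintro ⟨s, hs, hst⟩
    refine ⟨s.toAdd, hs, ?_⟩
    rw [← hlin, ofAdd_toAdd, ← toAdd_mul, hst, toAdd_ofAdd]
  · rintro ⟨s, hs, hst⟩
    refine ⟨.ofAdd s, hs, ?_⟩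
    apply Multiplicative.toAdd.injective
    rw [toAdd_mul, hlin, hst, toAdd_ofAdd]

theorem not_isBCIGroup_zmod_eight : ¬ IsBCIGroup (Multiplicative (ZMod 8)) := by
  intro hG
  let S : Finset (ZMod 8) := {0, 2, 1, 5}
  let T : Finset (ZMod 8) := {0, 6, 1, 5}
  let F : ZMod 8 → ZMod 8 := fun x => x + 4 * (x.val % 4 / 2 : ℕ)
  have hF : Function.Injective F := by decide
  have hST : ∀ x y, y - x ∈ S ↔ F y - F x ∈ T := by decide
  have hne : ∀ g u : ZMod 8, T ≠ S.image fun s => g + u * s := by decide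
  obtain ⟨g, u, h⟩ := exists_affine_of_isBCIGroup hG (S := S) (T := T)
    (Equiv.ofBijective F (Finite.injective_iff_bijective.mp hF)) hST
  exact hne g u (by exact_mod_cast h)

theorem not_isBCIGroup_zmod_twentySeven : ¬ IsBCIGroup (Multiplicative (ZMod 27)) := by
  intro hG
  let S : Finset (ZMod 27) := {x | x = 0 ∨ x = 3 ∨ x = 9 ∨ x.val % 3 = 1}
  let T : Finset (ZMod 27) := {x | x = 0 ∨ x = -3 ∨ x = -9 ∨ x.val % 3 = 1}
  let F : ZMod 27 → ZMod 27 := fun x => 2 * (x.val % 3 : ℕ) - x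
  have hF : Function.Injective F := by decide +kernel
  have hST : ∀ x y, y - x ∈ S ↔ F y - F x ∈ T := by decide +kernel
  have hne : ∀ g u : ZMod 27, T ≠ S.image fun s => g + u * s := by decide +kernel
  obtain ⟨g, u, h⟩ := exists_affine_of_isBCIGroup hG (S := S) (T := T)
    (Equiv.ofBijective F (Finite.injective_iff_bijective.mp hF)) hST
  exact hne g u (by exact_mod_cast h)

theorem not_isBCIGroup_zmod_prime_sq {p : ℕ} (hp : p.Prime) (h5 : 5 ≤ p) :
    ¬ IsBCIGroup (Multiplicative (ZMod (p ^ 2))) := by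
  intro hG
  have : Fact p.Prime := ⟨hp⟩
  let π : ZMod (p ^ 2) →+* ZMod p := ZMod.castHom (dvd_pow_self p two_ne_zero) _
  have hpp : (p : ZMod (p ^ 2)) * p = 0 := by
    rw [← Nat.cast_mul, ← sq, ZMod.natCast_self]
  have hπp : π p = 0 := by rw [map_natCast, ZMod.natCast_self]
  have hker : ∀ x, π x = 0 → ∃ b, x = p * b := by
    intro x hx
    rw [← ZMod.natCast_zmod_val x, map_natCast, ZMod.natCast_eq_zero_iff] at hx
    obtain ⟨b, hb⟩ := hx
    exact ⟨b, by rw [← ZMod.natCast_zmod_val x, hb, Nat.cast_mul]⟩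
  have hsmall : ∀ k : ℕ, 0 < k → k < 5 → (k : ZMod (p ^ 2)) * p ≠ 0 := by
    intro k hk0 hk5 hk
    rw [← Nat.cast_mul, ZMod.natCast_eq_zero_iff, sq] at hk
    have := Nat.le_of_dvd hk0 (Nat.dvd_of_mul_dvd_mul_right hp.pos hk)
    omega
  have hp1 : (p : ZMod (p ^ 2)) ≠ 0 := by simpa using hsmall 1 (by norm_num) (by norm_num)
  have hp3 : (3 : ZMod (p ^ 2)) * p ≠ 0 := by simpa using hsmall 3 (by norm_num) (by norm_num)
  have htwo : IsUnit (2 : ZMod (p ^ 2)) := by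
    have hcop : Nat.Coprime 2 (p ^ 2) :=
      ((Nat.coprime_primes Nat.prime_two hp).mpr (by omega)).pow_right 2
    exact_mod_cast (ZMod.isUnit_iff_coprime 2 (p ^ 2)).mpr hcop
  let S : Set (ZMod (p ^ 2)) := {x | x = 0 ∨ x = p ∨ π x = 1}
  let T : Set (ZMod (p ^ 2)) := {x | x = 0 ∨ x = 2 * p ∨ π x = 1}
  let c : ZMod p → ZMod (p ^ 2) := fun a => (a.val : ℕ)
  have hc : ∀ a, π (c a) = a := fun a => by simp [c]
  let F : ZMod (p ^ 2) → ZMod (p ^ 2) := fun x => 2 * x - c (π x)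
  have hπF : ∀ x, π (F x) = π x := fun x => by
    simp only [F, map_sub, map_mul, hc, map_ofNat]
    ring
  have hF : Function.Injective F := by
    intro x y hxy
    have hπ : π x = π y := by rw [← hπF x, hxy, hπF]
    have : 2 * x - c (π x) = 2 * y - c (π y) := hxy
    rw [hπ, sub_left_inj] at this
    exact htwo.mul_left_cancel this
  have hST : ∀ x y, y - x ∈ S ↔ F y - F x ∈ T := by
    intro x y
    have hπ : π (F y - F x) = π (y - x) := by
      rw [map_sub π (F y), map_sub π y, hπF, hπF]
    change (_ ∨ _ ∨ _) ↔ (_ ∨ _ ∨ _)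
    rw [hπ]
    by_cases hxy : π (y - x) = 0
    · have hF2 : F y - F x = 2 * (y - x) := by
        have : π y = π x := by rwa [map_sub, sub_eq_zero] at hxy
        simp only [F, this]
        ring
      rw [hF2, htwo.mul_right_eq_zero, htwo.mul_right_inj]
    · have h0 : ∀ z, π z = π (y - x) → z ≠ 0 ∧ z ≠ p ∧ z ≠ 2 * p := by
        intro z hz
        rw [← hz] at hxy
        refine ⟨?_, ?_, ?_⟩ <;> rintro rfl <;> simp [hπp] at hxy
      have hd := h0 _ rfl
      have hFd := h0 _ hπ
      tauto
  obtain ⟨g, u, h⟩ := exists_affine_of_isBCIGroup hG (S := S) (T := T)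
    (Equiv.ofBijective F (Finite.injective_iff_bijective.mp hF)) hST
  have hmem : ∀ s ∈ S, g + u * s ∈ T := fun s hs => h ▸ ⟨s, hs, rfl⟩
  have hπT : ∀ t ∈ T, π t = 0 ∨ π t = 1 := by
    rintro t (rfl | rfl | ht)
    · simp
    · simp [hπp]
    · exact Or.inr ht
  have hTker : ∀ t ∈ T, π t = 0 → t = 0 ∨ t = 2 * p := by
    rintro t (ht | ht | ht) h0
    · exact Or.inl ht
    · exact Or.inr ht
    · simp [ht] at h0
  have hu : π u ≠ 0 := by
    intro hu
    have hconst : ∀ t ∈ T, π t = π g := by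
      intro t ht
      rw [h] at ht
      obtain ⟨s, -, rfl⟩ := ht
      simp [hu]
    have h0 := hconst 0 (Or.inl rfl)
    have h1 := hconst 1 (Or.inr (Or.inr (map_one π)))
    rw [← h0] at h1
    simp at h1
  have hg : g ∈ T := by simpa using hmem 0 (Or.inl rfl)
  have hgu : g + u ∈ T := by simpa using hmem 1 (Or.inr (Or.inr (map_one π)))
  rcases hπT g hg with hg0 | hg1
  · have hu1 : π (u - 1) = 0 := by
      have := hπT _ hgu
      rw [map_add, hg0, zero_add] at this
      rw [map_sub, map_one, this.resolve_left hu, sub_self]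
    obtain ⟨b, hb⟩ := hker _ hu1
    have hup : u * p = p := by linear_combination (p : ZMod (p ^ 2)) * hb + b * hpp
    have hgp : g + p ∈ T := by simpa [hup] using hmem p (Or.inr (Or.inl rfl))
    rcases hTker g hg hg0 with rfl | rfl <;>
      rcases hTker _ hgp (by simp [hπp]) with h' | h'
    · exact hp1 (by linear_combination h')
    · exact hp1 (by linear_combination -h')
    · exact hp3 (by linear_combination h')
    · exact hp1 (by linear_combination h')
  · have hgu0 : π (g + u) = 0 := by
      refine (hπT _ hgu).resolve_right fun h1 => hu ?_
      rw [map_add, hg1] at h1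
      linear_combination h1
    have hu1 : π (u + 1) = 0 := by
      rw [map_add, hg1] at hgu0
      rw [map_add, map_one]
      linear_combination hgu0
    obtain ⟨b, hb⟩ := hker _ hu1
    obtain ⟨a, ha⟩ := hker _ hgu0
    have hup : u * p = -p := by linear_combination (p : ZMod (p ^ 2)) * hb + b * hpp
    have hmem_p : (p : ZMod (p ^ 2)) ∈ T := by
      convert hmem (1 + p * (a - 1)) (Or.inr (Or.inr (by simp [hπp]))) using 1
      linear_combination -ha - (a - 1) * hup
    rcases hTker _ hmem_p hπp with h' | h'
    · exact hp1 h'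
    · exact hp1 (by linear_combination -h')

end Cyclic

/-- If `ℤ_n` is a BCI-group then `n = 2^i 3^j p₁ ⋯ p_k` with `i, j ≤ 2` and the `p_t`
distinct primes `≥ 5`: i.e. `v₂(n) ≤ 2`, `v₃(n) ≤ 2` and `v_p(n) ≤ 1` for all primes `p ≥ 5`. -/
theorem cyclic_BCIGroup_factorization (n : ℕ) (hn : 0 < n)
    (hBCI : IsBCIGroup (Multiplicative (ZMod n))) :
    n.factorization 2 ≤ 2 ∧ n.factorization 3 ≤ 2 ∧
    ∀ p : ℕ, p.Prime → 5 ≤ p → n.factorization p ≤ 1 := by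
  have hbound : ∀ {p k : ℕ}, p.Prime → ¬ IsBCIGroup (Multiplicative (ZMod (p ^ (k + 1)))) →
      n.factorization p ≤ k := by
    intro p k hp hnot
    by_contra! hk
    exact hnot (hBCI.zmod_of_dvd hn ((hp.pow_dvd_iff_le_factorization hn.ne').mpr hk))
  exact ⟨hbound Nat.prime_two not_isBCIGroup_zmod_eight,
    hbound Nat.prime_three not_isBCIGroup_zmod_twentySeven,
    fun p hp h5 => hbound hp (not_isBCIGroup_zmod_prime_sq hp h5)⟩
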